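/- There exists a constant c > 0 such that if δ : Fin n × {a,b} → Fin n is a uniformly random transition function, then with probability tending to 1 as n → ∞, no word ω ∈ {a,b}* of length at most c·n^(1/3) is synchronizing; i.e., the shortest synchronizing word (if one exists) has length greater than c·n^(1/3). -/

import Mathlib

open scoped BigOperators Classical

/-- `run δ ω x` applies the transitions of the word `ω` (over the two-letter
alphabet `Bool`, with `false = 'a'` and `true = 'b'`) starting from state `x`,
i.e. `run δ ω = δ_ω = δ_{ω_k} ∘ ⋯ ∘ δ_{ω_1}`. -/
def run {n : ℕ} (δ : Fin n × Bool → Fin n) : List Bool → Fin n → Fin n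
  | [], x => x
  | c :: w, x => run δ w (δ (x, c))

/-- `AgreeOn V f δ`: all transitions of `δ` out of states in `V` are those of `f`. -/
def AgreeOn {n : ℕ} (V : Finset (Fin n)) (f δ : Fin n × Bool → Fin n) : Prop :=
  ∀ x ∈ V, ∀ c, δ (x, c) = f (x, c)

/-- Replace the two transitions of `f` out of `y` by `g`. -/
def updateState {n : ℕ} (f : Fin n × Bool → Fin n) (y : Fin n) (g : Bool → Fin n) :
    Fin n × Bool → Fin n :=
  fun p => if p.1 = y then g p.2 else f p

lemma run_append {n : ℕ} (δ : Fin n × Bool → Fin n) (u v : List Bool) (x : Fin n) :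
    run δ (u ++ v) x = run δ v (run δ u x) := by
  induction u generalizing x with
  | nil => rfl
  | cons c u ih => exact ih _

/-- Revealing the transitions out of a new state splits a set of automata. -/
lemma card_agreeOn_le_sum {n : ℕ} (V : Finset (Fin n)) (f : Fin n × Bool → Fin n) (y : Fin n)
    (hy : y ∉ V) (P : (Fin n × Bool → Fin n) → Prop) [DecidablePred P] :
    (Finset.univ.filter (fun δ => AgreeOn V f δ ∧ P δ)).card ≤
      ∑ g : Bool → Fin n,
        (Finset.univ.filter
          (fun δ => AgreeOn (insert y V) (updateState f y g) δ ∧ P δ)).card := by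
  rw [Finset.card_eq_sum_card_fiberwise (f := fun δ : Fin n × Bool → Fin n => fun c => δ (y, c))
    (t := Finset.univ) (fun _ _ => Finset.mem_coe.2 (Finset.mem_univ _))]
  refine Finset.sum_le_sum fun g _ => Finset.card_le_card fun δ hδ => ?_
  simp only [Finset.mem_filter, Finset.mem_univ, true_and] at hδ ⊢
  obtain ⟨⟨hV, hP⟩, hg⟩ := hδ
  refine ⟨fun x hx c => ?_, hP⟩
  by_cases hxy : x = y
  · subst hxy
    simp [updateState, ← hg]
  · have hxV : x ∈ V := (Finset.mem_insert.1 hx).resolve_left hxy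
    simpa [updateState, hxy] using hV x hxV c

lemma pow_two_mul_sub_card_insert {n : ℕ} (V : Finset (Fin n)) (y : Fin n) (hy : y ∉ V) :
    n ^ (2 * (n - V.card)) = n ^ 2 * n ^ (2 * (n - (insert y V).card)) := by
  have h := Finset.card_le_univ (insert y V)
  rw [Finset.card_insert_of_notMem hy, Fintype.card_fin] at h
  rw [Finset.card_insert_of_notMem hy, ← pow_add]
  congr 1
  omega

lemma card_agreeOn_le {n : ℕ} (V : Finset (Fin n)) (f : Fin n × Bool → Fin n) :
    (Finset.univ.filter (fun δ => AgreeOn V f δ)).card ≤ n ^ (2 * (n - V.card)) := by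
  have hsub : Finset.univ.filter (fun δ => AgreeOn V f δ) ⊆
      Fintype.piFinset (fun p : Fin n × Bool => if p.1 ∈ V then {f p} else Finset.univ) := by
    intro δ hδ
    simp only [Finset.mem_filter, Finset.mem_univ, true_and] at hδ
    refine Fintype.mem_piFinset.2 fun p => ?_
    by_cases hp : p.1 ∈ V
    · simpa [hp] using hδ p.1 hp p.2
    · simp [hp]
  refine (Finset.card_le_card hsub).trans (le_of_eq ?_)
  rw [Fintype.card_piFinset, Fintype.prod_prod_type]
  have h : ∀ x : Fin n,
      ∏ c : Bool, (if x ∈ V then ({f (x, c)} : Finset (Fin n)) else Finset.univ).card =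
        if x ∈ V then 1 else n ^ 2 := by
    intro x
    by_cases hx : x ∈ V <;> simp [hx, sq]
  simp only [h]
  rw [Finset.prod_ite]
  simp only [Finset.prod_const_one, one_mul, Finset.prod_const]
  rw [← pow_mul]
  congr 2
  rw [Finset.filter_not, Finset.card_sdiff_of_subset (Finset.filter_subset _ _)]
  simp

lemma card_filter_apply_mem {n : ℕ} (S : Finset (Fin n)) (c : Bool) :
    (Finset.univ.filter (fun g : Bool → Fin n => g c ∈ S)).card = S.card * n := by
  have h : Finset.univ.filter (fun g : Bool → Fin n => g c ∈ S) =
      Fintype.piFinset (fun d => if d = c then S else Finset.univ) := by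
    ext g
    cases c <;> simp [Fintype.mem_piFinset]
  rw [h, Fintype.card_piFinset]
  cases c <;> simp [mul_comm]

/-- One exploration of the path of `w` from an unexplored state `y`: to reach the explored
target `z`, it has to enter the explored region at one of its `w.length` steps. -/
lemma card_agreeOn_path_le {n : ℕ} (Q : (Fin n × Bool → Fin n) → Prop) [DecidablePred Q]
    (z : Fin n) (M m C D : ℕ)
    (hQ : ∀ (V : Finset (Fin n)) (f : Fin n × Bool → Fin n), z ∈ V → V.card + m ≤ M →
      (Finset.univ.filter (fun δ => AgreeOn V f δ ∧ Q δ)).card * D ≤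
        C * n ^ (2 * (n - V.card)))
    (w : List Bool) (V : Finset (Fin n)) (f : Fin n × Bool → Fin n) (y : Fin n)
    (hz : z ∈ V) (hy : y ∉ V) (hM : V.card + w.length + m ≤ M) :
    (Finset.univ.filter (fun δ => AgreeOn V f δ ∧ Q δ ∧ run δ w y = z)).card * (D * n) ≤
      w.length * M * C * n ^ (2 * (n - V.card)) := by
  induction w generalizing V f y with
  | nil =>
    have h : Finset.univ.filter
        (fun δ : Fin n × Bool → Fin n => AgreeOn V f δ ∧ Q δ ∧ run δ [] y = z) = ∅ := by
      refine Finset.filter_eq_empty_iff.2 fun δ _ hδ => hy ?_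
      have : y = z := hδ.2.2
      rwa [this]
    simp [h]
  | cons c w ih =>
    have hcard := Finset.card_insert_of_notMem hy
    have hzS : z ∈ insert y V := Finset.mem_insert_of_mem hz
    rw [List.length_cons] at hM
    set S := insert y V with hS
    set B := n ^ (2 * (n - S.card)) with hB
    have hg : ∀ g : Bool → Fin n,
        (Finset.univ.filter (fun δ => AgreeOn S (updateState f y g) δ ∧
          Q δ ∧ run δ (c :: w) y = z)).card * (D * n) ≤
        (if g c ∈ S then n * C * B else 0) + w.length * M * C * B := by
      intro g
      by_cases hgc : g c ∈ S
      · rw [if_pos hgc]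
        refine le_trans ?_ (Nat.le_add_right _ _)
        have h1 := hQ S (updateState f y g) hzS (by omega)
        have h2 : (Finset.univ.filter (fun δ => AgreeOn S (updateState f y g) δ ∧
            Q δ ∧ run δ (c :: w) y = z)).card ≤
            (Finset.univ.filter (fun δ => AgreeOn S (updateState f y g) δ ∧ Q δ)).card :=
          Finset.card_le_card (Finset.monotone_filter_right _ fun δ _ h => ⟨h.1, h.2.1⟩)
        calc _ ≤ (Finset.univ.filter
                (fun δ => AgreeOn S (updateState f y g) δ ∧ Q δ)).card * (D * n) :=
              Nat.mul_le_mul_right _ h2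
          _ = (Finset.univ.filter
                (fun δ => AgreeOn S (updateState f y g) δ ∧ Q δ)).card * D * n := by ring
          _ ≤ C * B * n := Nat.mul_le_mul_right _ h1
          _ = n * C * B := by ring
      · rw [if_neg hgc, zero_add]
        refine le_trans (Nat.mul_le_mul_right _ (Finset.card_le_card ?_))
          (ih S (updateState f y g) (g c) hzS hgc (by omega))
        refine Finset.monotone_filter_right _ fun δ _ h => ⟨h.1, h.2.1, ?_⟩
        have hyc : δ (y, c) = g c := by
          simpa [updateState] using h.1 y (Finset.mem_insert_self _ _) c
        rw [← hyc]
        exact h.2.2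
    calc _ ≤ (∑ g : Bool → Fin n, (Finset.univ.filter (fun δ =>
              AgreeOn S (updateState f y g) δ ∧ Q δ ∧ run δ (c :: w) y = z)).card) * (D * n) :=
          Nat.mul_le_mul_right _ (card_agreeOn_le_sum V f y hy
            (fun δ => Q δ ∧ run δ (c :: w) y = z))
      _ ≤ ∑ g : Bool → Fin n,
            ((if g c ∈ S then n * C * B else 0) + w.length * M * C * B) := by
          rw [Finset.sum_mul]
          exact Finset.sum_le_sum fun g _ => hg g
      _ = S.card * n * (n * C * B) + n ^ 2 * (w.length * M * C * B) := by
          rw [Finset.sum_add_distrib, ← Finset.sum_filter, Finset.sum_const,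
            card_filter_apply_mem]
          simp
      _ ≤ M * n * (n * C * B) + n ^ 2 * (w.length * M * C * B) := by
          gcongr
          omega
      _ = _ := by
          rw [pow_two_mul_sub_card_insert V y hy, List.length_cons]
          ring

lemma card_agreeOn_run_eq_le {n : ℕ} (ω : List Bool) (z : Fin n) (M : ℕ) (hMn : M < n) (i : ℕ)
    (V : Finset (Fin n)) (f : Fin n × Bool → Fin n) (hz : z ∈ V)
    (hM : V.card + i * ω.length ≤ M) :
    (Finset.univ.filter (fun δ => AgreeOn V f δ ∧ ∀ x, run δ ω x = z)).card * n ^ i ≤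
      (ω.length * M) ^ i * n ^ (2 * (n - V.card)) := by
  induction i generalizing V f with
  | zero =>
    simp only [pow_zero, mul_one, one_mul]
    exact (Finset.card_le_card
      (Finset.monotone_filter_right _ fun δ _ h => h.1)).trans (card_agreeOn_le V f)
  | succ i ih =>
    obtain ⟨y, hy⟩ : ∃ y, y ∉ V := by
      by_contra! h
      have : V.card = n := by
        rw [Finset.eq_univ_iff_forall.2 h, Finset.card_univ, Fintype.card_fin]
      omega
    have h := card_agreeOn_path_le (fun δ => ∀ x, run δ ω x = z) z M (i * ω.length)
      ((ω.length * M) ^ i) (n ^ i) ih ω V f y hz hy (by rw [Nat.succ_mul] at hM; omega)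
    rw [← pow_succ] at h
    calc _ ≤ _ := Nat.mul_le_mul_right _ (Finset.card_le_card
          (Finset.monotone_filter_right _ fun δ _ h => ⟨h.1, h.2, h.2 y⟩))
      _ ≤ _ := h
      _ = _ := by ring

/-- The number of automata for which a given word is synchronizing. -/
lemma card_synchronized_le {n : ℕ} (ω : List Bool) (M i : ℕ) (hMn : M < n)
    (hM : 1 + i * ω.length ≤ M) :
    (Finset.univ.filter (fun δ : Fin n × Bool → Fin n => ∃ z, ∀ x, run δ ω x = z)).card *
      n ^ i ≤ n * ((ω.length * M) ^ i * n ^ (2 * n)) := by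
  have hz : ∀ z : Fin n,
      (Finset.univ.filter (fun δ : Fin n × Bool → Fin n => ∀ x, run δ ω x = z)).card * n ^ i ≤
        (ω.length * M) ^ i * n ^ (2 * n) := by
    intro z
    have h := card_agreeOn_le_sum ∅ (fun _ => z) z (Finset.notMem_empty z)
      (fun δ => ∀ x, run δ ω x = z)
    calc _ ≤ _ := Nat.mul_le_mul_right _ ((Finset.card_le_card
          (Finset.monotone_filter_right _ fun δ _ hδ =>
            ⟨fun x hx => absurd hx (Finset.notMem_empty x), hδ⟩)).trans h)
      _ ≤ ∑ g : Bool → Fin n,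
            (ω.length * M) ^ i * n ^ (2 * (n - (insert z (∅ : Finset (Fin n))).card)) := by
          rw [Finset.sum_mul]
          exact Finset.sum_le_sum fun g _ => card_agreeOn_run_eq_le ω z M hMn i _ _
            (Finset.mem_insert_self _ _) (by simpa using hM)
      _ = (ω.length * M) ^ i * n ^ (2 * (n - (∅ : Finset (Fin n)).card)) := by
          rw [pow_two_mul_sub_card_insert ∅ z (Finset.notMem_empty z), Finset.sum_const]
          simp
          ring
      _ = _ := by simp
  have hU : Finset.univ.filter (fun δ : Fin n × Bool → Fin n => ∃ z, ∀ x, run δ ω x = z) ⊆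
      Finset.univ.biUnion (fun z : Fin n =>
        Finset.univ.filter (fun δ : Fin n × Bool → Fin n => ∀ x, run δ ω x = z)) := by
    intro δ hδ
    simpa using hδ
  calc _ ≤ _ := Nat.mul_le_mul_right _ ((Finset.card_le_card hU).trans Finset.card_biUnion_le)
    _ ≤ ∑ z : Fin n, (ω.length * M) ^ i * n ^ (2 * n) := by
        rw [Finset.sum_mul]
        exact Finset.sum_le_sum fun z _ => hz z
    _ = _ := by simp

/-- The number of automata having a synchronizing word of length at most `K`. -/
lemma card_exists_short_synchronizing_le {n : ℕ} (K : ℕ) (hKn : 1 + K * K < n) :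
    (Finset.univ.filter (fun δ : Fin n × Bool → Fin n =>
      ∃ ω : List Bool, ω.length ≤ K ∧ (Finset.univ.image (run δ ω)).card = 1)).card * n ^ K ≤
      n * (2 * (K * (1 + K * K))) ^ K * n ^ (2 * n) := by
  have hU : Finset.univ.filter (fun δ : Fin n × Bool → Fin n =>
      ∃ ω : List Bool, ω.length ≤ K ∧ (Finset.univ.image (run δ ω)).card = 1) ⊆
      Finset.univ.biUnion (fun u : Fin K → Bool =>
        Finset.univ.filter
          (fun δ : Fin n × Bool → Fin n => ∃ z, ∀ x, run δ (List.ofFn u) x = z)) := by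
    intro δ hδ
    simp only [Finset.mem_filter, Finset.mem_univ, true_and, Finset.mem_biUnion] at hδ ⊢
    obtain ⟨ω, hω, hcard⟩ := hδ
    obtain ⟨z, hz⟩ := Finset.card_eq_one.1 hcard
    have hlen : (ω ++ List.replicate (K - ω.length) false).length = K := by
      simp
      omega
    obtain ⟨u, hu⟩ : ∃ u : Fin K → Bool,
        List.ofFn u = ω ++ List.replicate (K - ω.length) false := by
      generalize ω ++ List.replicate (K - ω.length) false = l at hlen
      subst hlen
      exact ⟨l.get, List.ofFn_get l⟩
    refine ⟨u, run δ (List.replicate (K - ω.length) false) z, fun x => ?_⟩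
    have hx : run δ ω x = z := by
      have := Finset.mem_image_of_mem (run δ ω) (Finset.mem_univ x)
      rwa [hz, Finset.mem_singleton] at this
    rw [hu, run_append, hx]
  calc _ ≤ _ := Nat.mul_le_mul_right _ ((Finset.card_le_card hU).trans Finset.card_biUnion_le)
    _ ≤ ∑ u : Fin K → Bool, n * ((K * (1 + K * K)) ^ K * n ^ (2 * n)) := by
        rw [Finset.sum_mul]
        refine Finset.sum_le_sum fun u _ => ?_
        have h := card_synchronized_le (n := n) (List.ofFn u) (1 + K * K) K hKn (by simp)
        rwa [List.length_ofFn] at h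
    _ = _ := by
        rw [Finset.sum_const, mul_pow 2]
        simp
        ring

/-- The proportion of automata having a synchronizing word of length at most `K`. -/
lemma short_synchronizing_ratio_le {n : ℕ} (K : ℕ) (hK : 1 ≤ K) (hn : 8 * K ^ 3 ≤ n) :
    ((Finset.univ.filter (fun δ : Fin n × Bool → Fin n =>
      ∃ ω : List Bool, ω.length ≤ K ∧ (Finset.univ.image (run δ ω)).card = 1)).card : ℝ) /
      (n : ℝ) ^ (2 * n) ≤ n * (1 / 2) ^ K := by
  have hK3 : 1 + K * K ≤ 2 * (K * K) := by nlinarith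
  have hK4 : K * K ≤ K ^ 3 := by
    calc K * K ≤ K * K * K := Nat.le_mul_of_pos_right _ hK
      _ = K ^ 3 := by ring
  have hK5 : 0 < K ^ 3 := by positivity
  have hn0 : (0 : ℝ) < n := by exact_mod_cast (by omega : 0 < n)
  have h := card_exists_short_synchronizing_le (n := n) K (by omega)
  rw [div_le_iff₀ (by positivity)]
  have hb : 2 * (2 * (K * (1 + K * K))) ≤ n := by
    calc 2 * (2 * (K * (1 + K * K))) ≤ 2 * (2 * (K * (2 * (K * K)))) := by gcongr
      _ = 8 * K ^ 3 := by ring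
      _ ≤ n := hn
  have hb' : ((2 * (K * (1 + K * K)) : ℕ) : ℝ) ≤ 1 / 2 * n := by
    have : ((2 * (2 * (K * (1 + K * K))) : ℕ) : ℝ) ≤ n := by exact_mod_cast hb
    push_cast at this ⊢
    linarith
  have h' : ((Finset.univ.filter (fun δ : Fin n × Bool → Fin n =>
      ∃ ω : List Bool, ω.length ≤ K ∧ (Finset.univ.image (run δ ω)).card = 1)).card : ℝ) *
      (n : ℝ) ^ K ≤
      n * ((2 * (K * (1 + K * K)) : ℕ) : ℝ) ^ K * (n : ℝ) ^ (2 * n) := by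
    exact_mod_cast h
  have h'' : (n : ℝ) * ((2 * (K * (1 + K * K)) : ℕ) : ℝ) ^ K * (n : ℝ) ^ (2 * n) ≤
      n * (1 / 2 * n) ^ K * (n : ℝ) ^ (2 * n) := by gcongr
  refine le_of_mul_le_mul_right (h'.trans (h''.trans (le_of_eq ?_)))
    (show (0 : ℝ) < (n : ℝ) ^ K by positivity)
  rw [mul_pow]
  ring

lemma tendsto_add_one_pow_three_mul_half_pow :
    Filter.Tendsto (fun K : ℕ => 8 * ((K : ℝ) + 1) ^ 3 * (1 / 2) ^ K) Filter.atTop (nhds 0) := by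
  have h := (Filter.tendsto_add_atTop_iff_nat 1).2
    (tendsto_pow_const_mul_const_pow_of_abs_lt_one 3 (r := (1 / 2 : ℝ)) (by norm_num [abs_of_pos]))
  have h2 := h.const_mul 16
  rw [mul_zero] at h2
  refine h2.congr fun K => ?_
  push_cast
  ring

/-- There is a constant `c > 0` such that, with probability
tending to `1`, a uniformly random automaton has no synchronizing word of
length at most `c·n^(1/3)`. -/
theorem no_short_synchronizing_word_whp :
    ∃ c : ℝ, 0 < c ∧
      Filter.Tendsto
        (fun n : ℕ =>
          ((Finset.univ.filter (fun δ : Fin n × Bool → Fin n =>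
              ∀ ω : List Bool,
                (ω.length : ℝ) ≤ c * (n : ℝ) ^ ((1 : ℝ) / 3) →
                  (Finset.univ.image (run δ ω)).card ≠ 1)).card : ℝ)
            / (n : ℝ) ^ (2 * n))
        Filter.atTop (nhds 1) := by
  refine ⟨1 / 2, by norm_num, ?_⟩
  set K : ℕ → ℕ := fun n => ⌊(1 / 2 : ℝ) * (n : ℝ) ^ ((1 : ℝ) / 3)⌋₊ with hKdef
  have hnonneg : ∀ n : ℕ, 0 ≤ (1 / 2 : ℝ) * (n : ℝ) ^ ((1 : ℝ) / 3) := fun n => by positivity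
  have hcube : ∀ n : ℕ, ((n : ℝ) ^ ((1 : ℝ) / 3)) ^ 3 = n := fun n => by
    rw [← Real.rpow_natCast, ← Real.rpow_mul (Nat.cast_nonneg n)]
    norm_num
  have hKlim : Filter.Tendsto K Filter.atTop Filter.atTop :=
    tendsto_nat_floor_atTop.comp (((tendsto_rpow_atTop (by norm_num : (0 : ℝ) < 1 / 3)).comp
      tendsto_natCast_atTop_atTop).const_mul_atTop (by norm_num))
  have hlow : ∀ n, 8 * K n ^ 3 ≤ n := fun n => by
    have h1 : (K n : ℝ) ≤ 1 / 2 * (n : ℝ) ^ ((1 : ℝ) / 3) := Nat.floor_le (hnonneg n)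
    have h2 := pow_le_pow_left₀ (Nat.cast_nonneg (K n)) h1 3
    rw [mul_pow, hcube] at h2
    have : (8 : ℝ) * (K n : ℝ) ^ 3 ≤ n := by linarith
    exact_mod_cast this
  have hup : ∀ n : ℕ, (n : ℝ) ≤ 8 * ((K n : ℝ) + 1) ^ 3 := fun n => by
    have h1 : 1 / 2 * (n : ℝ) ^ ((1 : ℝ) / 3) ≤ (K n : ℝ) + 1 := (Nat.lt_floor_add_one _).le
    have h2 := pow_le_pow_left₀ (hnonneg n) h1 3
    rw [mul_pow, hcube] at h2
    linarith
  set bad : ℕ → ℝ := fun n => ((Finset.univ.filter (fun δ : Fin n × Bool → Fin n =>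
      ∃ ω : List Bool, ω.length ≤ K n ∧ (Finset.univ.image (run δ ω)).card = 1)).card : ℝ) /
      (n : ℝ) ^ (2 * n) with hbad
  have hbadlim : Filter.Tendsto bad Filter.atTop (nhds 0) := by
    refine squeeze_zero' (Filter.Eventually.of_forall fun n => by positivity) ?_
      (tendsto_add_one_pow_three_mul_half_pow.comp hKlim)
    filter_upwards [hKlim.eventually_ge_atTop 1] with n hn
    refine (short_synchronizing_ratio_le (K n) hn (hlow n)).trans ?_
    exact mul_le_mul_of_nonneg_right (hup n) (by positivity)
  have hlim := hbadlim.const_sub 1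
  rw [sub_zero] at hlim
  refine hlim.congr' ?_
  filter_upwards [Filter.eventually_gt_atTop 0] with n hn
  have hn0 : (0 : ℝ) < n := by exact_mod_cast hn
  have hpos : (0 : ℝ) < (n : ℝ) ^ (2 * n) := by positivity
  rw [hbad, sub_eq_iff_eq_add, ← add_div, eq_div_iff hpos.ne', one_mul, ← Nat.cast_add]
  have hsplit := Finset.card_filter_add_card_filter_not (s := Finset.univ)
    (fun δ : Fin n × Bool → Fin n => ∀ ω : List Bool,
      (ω.length : ℝ) ≤ 1 / 2 * (n : ℝ) ^ ((1 : ℝ) / 3) →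
        (Finset.univ.image (run δ ω)).card ≠ 1)
  have hcard : (Finset.univ : Finset (Fin n × Bool → Fin n)).card = n ^ (2 * n) := by
    simp [mul_comm]
  have hnot : ∀ δ : Fin n × Bool → Fin n,
      (∃ ω : List Bool, ω.length ≤ K n ∧ (Finset.univ.image (run δ ω)).card = 1) ↔
      ¬ ∀ ω : List Bool, (ω.length : ℝ) ≤ 1 / 2 * (n : ℝ) ^ ((1 : ℝ) / 3) →
        (Finset.univ.image (run δ ω)).card ≠ 1 := by
    intro δ
    push Not
    simp only [hKdef, Nat.le_floor_iff (hnonneg n)]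
  simp only [hnot]
  rw [hsplit, hcard]
  push_cast
  rfl
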